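/- arXiv:0809.1226 — 2 statements merged into one kernel-verified Lean document; each statement's English description precedes it below -/
import Mathlib

section
/- For any i.i.d. source P generating letters from a finite alphabet A and any integer t ≥ 1, the average prediction error of the Laplace predictor satisfies ρ^t(P‖L_0) ≤ (|A| − 1)·log e / (t + 1), and the per-letter estimation error satisfies ρ̄^t(P‖L_0) ≤ (|A| − 1)·log t / t + O(1/t). -/
open MeasureTheory Filter Real

/-- The time shift on one-sided infinite sequences. -/
def shiftMap (A : Type) : (ℕ → A) → (ℕ → A) := fun x n => x (n + 1)

/-- The word consisting of the first `t` letters of an infinite sequence. -/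
def prefixWord {A : Type} (t : ℕ) (x : ℕ → A) : Fin t → A := fun i => x i.val

/-- The probability that a source `μ` generates a sequence starting with the word `u`. -/
noncomputable def wordProb {A : Type} [MeasurableSpace A] (μ : Measure (ℕ → A)) {t : ℕ}
    (u : Fin t → A) : ℝ :=
  (μ {x : ℕ → A | ∀ i : Fin t, x i.val = u i}).toReal

/-- The `m`-order conditional Shannon entropy `h_m(P)` (base-2 logarithms). -/
noncomputable def condEnt {A : Type} [MeasurableSpace A] [Fintype A]
    (μ : Measure (ℕ → A)) (m : ℕ) : ℝ :=
  - ∑ v : Fin m → A, wordProb μ v * ∑ a : A,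
      (wordProb μ (Fin.snoc v a) / wordProb μ v) *
        Real.logb 2 (wordProb μ (Fin.snoc v a) / wordProb μ v)

/-- The limiting Shannon entropy `h_∞(P) = lim_m h_m(P)`. -/
noncomputable def entRate {A : Type} [MeasurableSpace A] [Fintype A]
    (μ : Measure (ℕ → A)) : ℝ :=
  limUnder Filter.atTop (fun m => condEnt μ m)

/-- A uniquely decodable code: a family of maps `A^t → {0,1}^*` such that any
concatenation of codewords of words from `A^t` is uniquely decodable. -/
structure UDCode (A : Type) where
  enc : ∀ t : ℕ, (Fin t → A) → List Bool
  ud : ∀ t : ℕ, Function.Injective (fun l : List (Fin t → A) => (l.map (enc t)).flatten)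

/-- The measure associated with a code: `μ_U(u) = 2^{-|U(u)|} / Σ_v 2^{-|U(v)|}`. -/
noncomputable def muU {A : Type} [Fintype A] (U : UDCode A) {t : ℕ} (u : Fin t → A) : ℝ :=
  (2 : ℝ) ^ (-((U.enc t u).length : ℤ)) /
    ∑ v : Fin t → A, (2 : ℝ) ^ (-((U.enc t v).length : ℤ))

/-- A code is universal if, for every stationary ergodic source, the per-letter codeword
length converges to the limiting Shannon entropy a.s. and in expectation. -/
def IsUniversal {A : Type} [Fintype A] [MeasurableSpace A] (U : UDCode A) : Prop :=
  ∀ μ : Measure (ℕ → A), IsProbabilityMeasure μ → Ergodic (shiftMap A) μ →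
    (∀ᵐ x ∂μ, Tendsto (fun t : ℕ => ((U.enc t (prefixWord t x)).length : ℝ) / t) atTop
      (nhds (entRate μ))) ∧
    Tendsto (fun t : ℕ => (∫ x, ((U.enc t (prefixWord t x)).length : ℝ) ∂μ) / t) atTop
      (nhds (entRate μ))

/-- The number of occurrences of `v` as a contiguous subword of `x`. -/
def subwordCount {A : Type} [DecidableEq A] (x v : List A) : ℕ :=
  ((List.range (x.length + 1)).filter (fun i => (x.drop i).take v.length = v)).length

/-- Occurrence count `ν_x(v)` for words given as tuples. -/
def nuCount {A : Type} [DecidableEq A] {t k : ℕ} (x : Fin t → A) (v : Fin k → A) : ℕ :=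
  subwordCount (List.ofFn x) (List.ofFn v)

/-- `ν̄_x(v) = Σ_{a∈A} ν_x(va)`. -/
def nubar {A : Type} [Fintype A] [DecidableEq A] {t m : ℕ} (x : Fin t → A)
    (v : Fin m → A) : ℕ :=
  ∑ a : A, nuCount x (Fin.snoc v a)

/-- The Krichevsky measure `K_m` of order `m`. -/
noncomputable def KMeas {A : Type} [Fintype A] [DecidableEq A] (m : ℕ) {t : ℕ}
    (x : Fin t → A) : ℝ :=
  if t ≤ m then ((Fintype.card A : ℝ))⁻¹ ^ t
  else ((Fintype.card A : ℝ))⁻¹ ^ m *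
    ∏ v : Fin m → A,
      (∏ a : A, Real.Gamma ((nuCount x (Fin.snoc v a) : ℝ) + 1 / 2) / Real.Gamma (1 / 2)) /
        (Real.Gamma ((nubar x v : ℝ) + (Fintype.card A : ℝ) / 2) /
          Real.Gamma ((Fintype.card A : ℝ) / 2))

/-- The probability distribution `ω` on positive integers:
`ω_1 = 1 − 1/log 3`, `ω_i = 1/log(i+1) − 1/log(i+2)` for `i ≥ 2`. -/
noncomputable def omegaW (i : ℕ) : ℝ :=
  if i = 1 then 1 - 1 / Real.logb 2 3
  else 1 / Real.logb 2 (i + 1) - 1 / Real.logb 2 (i + 2)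

/-- The measure `R(u) = Σ_{i=0}^∞ ω_{i+1} K_i(u)`. -/
noncomputable def RMeas {A : Type} [Fintype A] [DecidableEq A] {t : ℕ} (x : Fin t → A) : ℝ :=
  ∑' i : ℕ, omegaW (i + 1) * KMeas i x

/-- The last `k` letters of a word of length `t ≥ k`. -/
def suffixWord {A : Type} {t : ℕ} (k : ℕ) (h : k ≤ t) (u : Fin t → A) : Fin k → A :=
  fun j => u ⟨t - k + j.val, by have := j.isLt; omega⟩

/-- A source is Markov of order (memory) at most `k`: the conditional probability of
the next letter given the whole past equals that given the last `k` letters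
(in cross-multiplied form). -/
def IsMarkov {A : Type} [MeasurableSpace A] (μ : Measure (ℕ → A)) (k : ℕ) : Prop :=
  ∀ t : ℕ, ∀ h : k ≤ t, ∀ u : Fin t → A, ∀ a : A,
    wordProb μ (Fin.snoc u a) * wordProb μ (suffixWord k h u)
      = wordProb μ u * wordProb μ (Fin.snoc (suffixWord k h u) a)

/-- The probability an i.i.d. source with letter distribution `p` assigns to a word. -/
def iidProb {A : Type} (p : A → ℝ) {t : ℕ} (u : Fin t → A) : ℝ := ∏ i : Fin t, p (u i)

/-- The number of occurrences of the letter `a` in the word `x`. -/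
def countLetter {A : Type} [DecidableEq A] {t : ℕ} (x : Fin t → A) (a : A) : ℕ :=
  (Finset.univ.filter (fun i => x i = a)).card

/-- The prefix of `u` of length `i`. -/
def prefixOf {A : Type} {t : ℕ} (u : Fin t → A) (i : Fin t) : Fin i.val → A :=
  fun j => u ⟨j.val, j.isLt.trans i.isLt⟩

/-- The Laplace conditional probability `L_0(a|x) = (ν_x(a)+1)/(t+|A|)`. -/
noncomputable def laplaceCond {A : Type} [Fintype A] [DecidableEq A] {t : ℕ}
    (x : Fin t → A) (a : A) : ℝ :=
  ((countLetter x a : ℝ) + 1) / ((t : ℝ) + (Fintype.card A : ℝ))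

/-- The Laplace measure `L_0(x_1…x_t) = ∏_i L_0(x_i | x_1…x_{i-1})`. -/
noncomputable def laplaceMeas {A : Type} [Fintype A] [DecidableEq A] {t : ℕ}
    (u : Fin t → A) : ℝ :=
  ∏ i : Fin t, laplaceCond (prefixOf u i) (u i)

/-- The Krichevsky measure `K_0` for i.i.d. sources (via the Gamma-function formula). -/
noncomputable def K0Meas {A : Type} [Fintype A] [DecidableEq A] {t : ℕ} (u : Fin t → A) : ℝ :=
  (∏ a : A, Real.Gamma ((countLetter u a : ℝ) + 1 / 2) / Real.Gamma (1 / 2)) /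
    (Real.Gamma ((t : ℝ) + (Fintype.card A : ℝ) / 2) / Real.Gamma ((Fintype.card A : ℝ) / 2))

theorem sum_words_insertNth {A : Type} [Fintype A] {t : ℕ} (j : Fin (t + 1))
    (F : (Fin (t + 1) → A) → ℝ) :
    ∑ w, F w = ∑ u : Fin t → A, ∑ a : A, F (j.insertNth (α := fun _ => A) a u) := by
  rw [← (Fin.insertNthEquiv (fun _ => A) j).sum_comp, Fintype.sum_prod_type_right]
  rfl

theorem iidProb_insertNth {A : Type} (p : A → ℝ) {t : ℕ} (j : Fin (t + 1)) (a : A)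
    (u : Fin t → A) :
    iidProb p (j.insertNth (α := fun _ => A) a u) = p a * iidProb p u := by
  simp [iidProb, Fin.prod_univ_succAbove _ j]

theorem countLetter_insertNth {A : Type} [DecidableEq A] {t : ℕ} (j : Fin (t + 1)) (a b : A)
    (u : Fin t → A) :
    countLetter (j.insertNth (α := fun _ => A) b u) a
      = (if b = a then 1 else 0) + countLetter u a := by
  simp only [countLetter, Finset.card_filter, Fin.sum_univ_succAbove _ j,
    Fin.insertNth_apply_same, Fin.insertNth_apply_succAbove]

theorem iidProb_nonneg {A : Type} {p : A → ℝ} (hp : ∀ a, 0 ≤ p a) {t : ℕ} (u : Fin t → A) :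
    0 ≤ iidProb p u :=
  Finset.prod_nonneg fun _ _ => hp _

theorem sum_iidProb {A : Type} [Fintype A] {p : A → ℝ} (hp : ∑ a, p a = 1) (t : ℕ) :
    ∑ u : Fin t → A, iidProb p u = 1 := by
  induction t with
  | zero => simp [iidProb]
  | succ t ih =>
    simp only [sum_words_insertNth (Fin.last t), iidProb_insertNth, ← Finset.sum_mul, hp, one_mul,
      ih]

/-- If `ν` is binomial with parameters `t` and `p a`, then `E[p a / (ν + 1)] ≤ 1 / (t + 1)`. -/
theorem sum_iidProb_mul_div_countLetter_add_one_le {A : Type} [Fintype A] [DecidableEq A]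
    {p : A → ℝ} (hp : ∀ a, 0 ≤ p a) (hp1 : ∑ a, p a = 1) (t : ℕ) (a : A) :
    ∑ u : Fin t → A, iidProb p u * (p a / (countLetter u a + 1)) ≤ 1 / ((t : ℝ) + 1) := by
  have key : ∀ j : Fin (t + 1), ∑ u : Fin t → A, iidProb p u * (p a / (countLetter u a + 1))
      = ∑ w : Fin (t + 1) → A,
          iidProb p w * (if w j = a then ((countLetter w a : ℝ))⁻¹ else 0) := by
    intro j
    rw [sum_words_insertNth j]
    refine Finset.sum_congr rfl fun u _ => ?_
    rw [Finset.sum_eq_single a]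
    · simp only [iidProb_insertNth, countLetter_insertNth, Fin.insertNth_apply_same, if_true]
      push_cast
      rw [add_comm (1 : ℝ)]
      ring
    · intro b _ hb
      simp [hb]
    · simp
  have total : ((t : ℝ) + 1) * ∑ u : Fin t → A, iidProb p u * (p a / (countLetter u a + 1)) ≤ 1 :=
    calc ((t : ℝ) + 1) * ∑ u : Fin t → A, iidProb p u * (p a / (countLetter u a + 1))
        = ∑ _j : Fin (t + 1), ∑ u : Fin t → A, iidProb p u * (p a / (countLetter u a + 1)) := by
          simp
      _ = ∑ w : Fin (t + 1) → A, iidProb p w *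
            ∑ j, (if w j = a then ((countLetter w a : ℝ))⁻¹ else 0) := by
          rw [Finset.sum_congr rfl fun j _ => key j, Finset.sum_comm]
          simp only [Finset.mul_sum]
      _ ≤ ∑ w : Fin (t + 1) → A, iidProb p w := by
          refine Finset.sum_le_sum fun w _ => mul_le_of_le_one_right (iidProb_nonneg hp w) ?_
          rw [← Finset.sum_filter, Finset.sum_const, nsmul_eq_mul]
          exact mul_inv_le_one
      _ = 1 := sum_iidProb hp1 _
  rw [le_div_iff₀ (by positivity)]
  linarith

theorem laplaceCond_pos {A : Type} [Fintype A] [DecidableEq A] [Nonempty A] {t : ℕ}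
    (x : Fin t → A) (a : A) : 0 < laplaceCond x a := by
  have : 0 < Fintype.card A := Fintype.card_pos
  unfold laplaceCond
  positivity

theorem laplaceMeas_pos {A : Type} [Fintype A] [DecidableEq A] [Nonempty A] {t : ℕ}
    (u : Fin t → A) : 0 < laplaceMeas u :=
  Finset.prod_pos fun _ _ => laplaceCond_pos _ _

theorem laplaceMeas_snoc {A : Type} [Fintype A] [DecidableEq A] {t : ℕ} (u : Fin t → A) (a : A) :
    laplaceMeas (Fin.snoc (α := fun _ => A) u a) = laplaceMeas u * laplaceCond u a := by
  unfold laplaceMeas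
  rw [Fin.prod_univ_castSucc]
  have hpre : ∀ i : Fin t, prefixOf (Fin.snoc (α := fun _ => A) u a) i.castSucc = prefixOf u i := by
    intro i
    funext j
    exact Fin.snoc_castSucc (α := fun _ => A) a u ⟨j, j.isLt.trans i.isLt⟩
  have hlast : prefixOf (Fin.snoc (α := fun _ => A) u a) (Fin.last t) = u := by
    funext j
    exact Fin.snoc_castSucc (α := fun _ => A) a u j
  congr 1
  · refine Finset.prod_congr rfl fun i _ => ?_
    rw [Fin.snoc_castSucc]
    exact congrArg (laplaceCond · (u i)) (hpre i)
  · rw [Fin.snoc_last]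
    exact congrArg (laplaceCond · a) hlast

theorem mul_logb_div_le {x y : ℝ} (hx : 0 ≤ x) (hy : 0 < y) :
    x * logb 2 (x / y) ≤ (x * (x / y) - x) * logb 2 (exp 1) := by
  rcases hx.eq_or_lt with rfl | hx
  · simp
  have h2 : 0 < log 2 := log_pos one_lt_two
  have hlog := mul_le_mul_of_nonneg_left (log_le_sub_one_of_pos (div_pos hx hy)) hx.le
  rw [logb, logb, log_exp, ← mul_div_assoc, mul_one_div]
  gcongr
  linarith

theorem laplace_prediction_error_le {A : Type} [Fintype A] [DecidableEq A] [Nonempty A]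
    {p : A → ℝ} (hp : ∀ a, 0 ≤ p a) (hp1 : ∑ a, p a = 1) (t : ℕ) :
    (∑ u : Fin t → A, iidProb p u * ∑ a : A, p a * logb 2 (p a / laplaceCond u a))
      ≤ ((Fintype.card A : ℝ) - 1) * logb 2 (exp 1) / ((t : ℝ) + 1) := by
  have he : 0 ≤ logb 2 (exp 1) := logb_nonneg one_lt_two (one_le_exp zero_le_one)
  have hsum : ∑ u : Fin t → A, iidProb p u * ∑ a : A, p a * (p a / laplaceCond u a)
      ≤ ((t : ℝ) + Fintype.card A) / (t + 1) :=
    calc ∑ u : Fin t → A, iidProb p u * ∑ a : A, p a * (p a / laplaceCond u a)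
        = ∑ a : A, p a * ((t + Fintype.card A) *
            ∑ u : Fin t → A, iidProb p u * (p a / (countLetter u a + 1))) := by
          simp only [Finset.mul_sum]
          rw [Finset.sum_comm]
          refine Finset.sum_congr rfl fun a _ => Finset.sum_congr rfl fun u _ => ?_
          rw [laplaceCond, div_div_eq_mul_div]
          ring
      _ ≤ ∑ a : A, p a * ((t + Fintype.card A) * (1 / ((t : ℝ) + 1))) := by
          gcongr with a
          · exact hp a
          · exact sum_iidProb_mul_div_countLetter_add_one_le hp hp1 t a
      _ = ((t : ℝ) + Fintype.card A) / (t + 1) := by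
          rw [← Finset.sum_mul, hp1]
          ring
  calc (∑ u : Fin t → A, iidProb p u * ∑ a : A, p a * logb 2 (p a / laplaceCond u a))
      ≤ ∑ u : Fin t → A, iidProb p u *
          ∑ a : A, (p a * (p a / laplaceCond u a) - p a) * logb 2 (exp 1) := by
        refine Finset.sum_le_sum fun u _ => mul_le_mul_of_nonneg_left ?_ (iidProb_nonneg hp u)
        exact Finset.sum_le_sum fun a _ => mul_logb_div_le (hp a) (laplaceCond_pos u a)
    _ = (∑ u : Fin t → A, iidProb p u * ∑ a : A, p a * (p a / laplaceCond u a) - 1)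
          * logb 2 (exp 1) := by
        simp only [← Finset.sum_mul, Finset.sum_sub_distrib, hp1, ← mul_assoc, mul_sub, mul_one,
          sum_iidProb hp1]
    _ ≤ (((t : ℝ) + Fintype.card A) / (t + 1) - 1) * logb 2 (exp 1) := by gcongr
    _ = ((Fintype.card A : ℝ) - 1) * logb 2 (exp 1) / ((t : ℝ) + 1) := by
        field_simp
        ring

/-- Chain rule for the divergence between an i.i.d. source and the Laplace measure. -/
theorem sum_iidProb_mul_logb_div_laplaceMeas_succ {A : Type} [Fintype A] [DecidableEq A]
    [Nonempty A] {p : A → ℝ} (hp1 : ∑ a, p a = 1) (t : ℕ) :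
    ∑ w : Fin (t + 1) → A, iidProb p w * logb 2 (iidProb p w / laplaceMeas w)
      = ∑ u : Fin t → A, iidProb p u * logb 2 (iidProb p u / laplaceMeas u)
        + ∑ u : Fin t → A, iidProb p u * ∑ a : A, p a * logb 2 (p a / laplaceCond u a) := by
  rw [sum_words_insertNth (Fin.last t), ← Finset.sum_add_distrib]
  refine Finset.sum_congr rfl fun u _ => ?_
  have hsnoc : ∀ a : A, iidProb p (Fin.snoc (α := fun _ => A) u a) = p a * iidProb p u := by
    intro a
    rw [← Fin.insertNth_last', iidProb_insertNth]
  have hterm : ∀ a : A, p a * iidProb p u *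
      logb 2 (p a * iidProb p u / (laplaceMeas u * laplaceCond u a))
      = p a * (iidProb p u * logb 2 (iidProb p u / laplaceMeas u))
        + iidProb p u * (p a * logb 2 (p a / laplaceCond u a)) := by
    intro a
    by_cases ha : p a = 0
    · simp [ha]
    by_cases hu : iidProb p u = 0
    · simp [hu]
    rw [mul_comm (laplaceMeas u), mul_div_mul_comm,
      logb_mul (div_ne_zero ha (laplaceCond_pos u a).ne') (div_ne_zero hu (laplaceMeas_pos u).ne')]
    ring
  simp only [Fin.insertNth_last', hsnoc, laplaceMeas_snoc, hterm,
    Finset.sum_add_distrib, ← Finset.sum_mul, hp1, one_mul, Finset.mul_sum]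

theorem sum_iidProb_mul_logb_div_laplaceMeas_le {A : Type} [Fintype A] [DecidableEq A]
    [Nonempty A] {p : A → ℝ} (hp : ∀ a, 0 ≤ p a) (hp1 : ∑ a, p a = 1) (t : ℕ) :
    ∑ u : Fin t → A, iidProb p u * logb 2 (iidProb p u / laplaceMeas u)
      ≤ ((Fintype.card A : ℝ) - 1) * logb 2 (exp 1) * (harmonic t : ℝ) := by
  induction t with
  | zero => simp [iidProb, laplaceMeas]
  | succ t ih =>
    rw [sum_iidProb_mul_logb_div_laplaceMeas_succ hp1, harmonic_succ]
    push_cast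
    rw [mul_add, ← div_eq_mul_inv]
    exact add_le_add ih (laplace_prediction_error_le hp hp1 t)

/-- error of the Laplace predictor, Claim 1 of the paper.
For any i.i.d. source `P` on a finite alphabet `A` and any `t ≥ 1`,
`ρ^t(P‖L_0) ≤ (|A|−1)·log e/(t+1)`, and
`ρ̄^t(P‖L_0) ≤ (|A|−1)·log t/t + O(1/t)`. -/
theorem laplace_predictor_error (A : Type) [Fintype A] [DecidableEq A] [Nonempty A] :
    (∀ p : A → ℝ, (∀ a, 0 ≤ p a) → (∑ a : A, p a) = 1 → ∀ t : ℕ, 1 ≤ t →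
      (∑ u : Fin t → A, iidProb p u * ∑ a : A, p a * Real.logb 2 (p a / laplaceCond u a))
        ≤ ((Fintype.card A : ℝ) - 1) * Real.logb 2 (Real.exp 1) / ((t : ℝ) + 1)) ∧
    (∃ C : ℝ, ∀ p : A → ℝ, (∀ a, 0 ≤ p a) → (∑ a : A, p a) = 1 → ∀ t : ℕ, 1 ≤ t →
      (t : ℝ)⁻¹ * (∑ u : Fin t → A, iidProb p u * Real.logb 2 (iidProb p u / laplaceMeas u))
        ≤ ((Fintype.card A : ℝ) - 1) * Real.logb 2 t / t + C / t) := by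
  refine ⟨fun p hp hp1 t _ => laplace_prediction_error_le hp hp1 t,
    ((Fintype.card A : ℝ) - 1) * logb 2 (exp 1), fun p hp hp1 t _ => ?_⟩
  have hcard : (1 : ℝ) ≤ Fintype.card A := by exact_mod_cast Fintype.card_pos (α := A)
  have he : 0 ≤ logb 2 (exp 1) := logb_nonneg one_lt_two (one_le_exp zero_le_one)
  have hlog : logb 2 (t : ℝ) = logb 2 (exp 1) * log t := by
    rw [logb, logb, log_exp]
    ring
  have hbound := (sum_iidProb_mul_logb_div_laplaceMeas_le hp hp1 t).trans
    (mul_le_mul_of_nonneg_left (harmonic_le_one_add_log t)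
      (mul_nonneg (sub_nonneg.2 hcard) he))
  rw [← add_div, inv_mul_eq_div, hlog]
  gcongr
  linarith
end

section
/- Let U be a universal code over a finite alphabet A and define the measure μ_U(u) = 2^{−|U(u)|} / Σ_{v ∈ A^{|u|}} 2^{−|U(v)|}. Then for any stationary and ergodic source P: (i) lim_{t→∞} (1/t)( −log P(x_1…x_t) − (−log μ_U(x_1…x_t)) ) = 0 with P-probability 1, and (ii) lim_{t→∞} (1/t) Σ_{u ∈ A^t} P(u) log( P(u)/μ_U(u) ) = 0. -/
open MeasureTheory Filter Real

/-! ### Cylinder functions and the transfer operator of the shift -/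

/-- Prepend a letter to a sequence. -/
def consSeq {A : Type} (a : A) (x : ℕ → A) : ℕ → A := fun n => Nat.casesOn n a x

/-- Prepend a word to a sequence. -/
def appendSeq {A : Type} {t : ℕ} (u : Fin t → A) (x : ℕ → A) : ℕ → A :=
  fun n => if h : n < t then u ⟨n, h⟩ else x (n - t)

/-- The transfer operator of the shift: sum over all preimages. -/
def transferOp {A : Type} [Fintype A] (f : (ℕ → A) → ℝ) : (ℕ → A) → ℝ :=
  fun x => ∑ a : A, f (consSeq a x)

/-- The probability of the first `t` letters of a sequence. -/
noncomputable def prefixProb {A : Type} [MeasurableSpace A] (μ : Measure (ℕ → A)) (t : ℕ)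
    (x : ℕ → A) : ℝ :=
  wordProb μ (prefixWord t x)

theorem shiftMap_iterate_apply {A : Type} (n : ℕ) (x : ℕ → A) (i : ℕ) :
    (shiftMap A)^[n] x i = x (i + n) := by
  induction n generalizing x with
  | zero => rfl
  | succ n ih => rw [Function.iterate_succ_apply, ih, shiftMap, add_assoc]

theorem shiftMap_consSeq {A : Type} (a : A) (x : ℕ → A) : shiftMap A (consSeq a x) = x := rfl

theorem prefixWord_appendSeq {A : Type} {t : ℕ} (u : Fin t → A) (x : ℕ → A) :
    prefixWord t (appendSeq u x) = u := by
  funext i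
  simp [prefixWord, appendSeq]

theorem shiftMap_iterate_appendSeq {A : Type} {t : ℕ} (u : Fin t → A) (x : ℕ → A) :
    (shiftMap A)^[t] (appendSeq u x) = x := by
  funext i
  simp [shiftMap_iterate_apply, appendSeq]

theorem appendSeq_prefixWord {A : Type} {t : ℕ} (x y : ℕ → A) {i : ℕ} (hi : i < t) :
    appendSeq (prefixWord t x) y i = x i := by
  simp [prefixWord, appendSeq, hi]

theorem appendSeq_cons {A : Type} {t : ℕ} (a : A) (u : Fin t → A) (x : ℕ → A) :
    appendSeq (Fin.cons a u : Fin (t + 1) → A) x = consSeq a (appendSeq u x) := by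
  funext n
  cases n with
  | zero => simp [appendSeq, consSeq]
  | succ n =>
    by_cases h : n < t
    · have h' : n + 1 < t + 1 := by omega
      simp only [appendSeq, consSeq, dif_pos h, dif_pos h']
      exact Fin.cons_succ (α := fun _ => A) a u ⟨n, h⟩
    · simp [appendSeq, consSeq, h]

theorem transferOp_iterate_apply {A : Type} [Fintype A] (t : ℕ) (f : (ℕ → A) → ℝ)
    (x : ℕ → A) : transferOp^[t] f x = ∑ u : Fin t → A, f (appendSeq u x) := by
  induction t generalizing f with
  | zero =>
    have h (u : Fin 0 → A) : appendSeq u x = x := by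
      funext n
      simp [appendSeq]
    simp [h]
  | succ t ih =>
    rw [Function.iterate_succ_apply, ih,
      ← (Fin.consEquiv fun _ : Fin (t + 1) => A).sum_comp, Fintype.sum_prod_type_right]
    refine Finset.sum_congr rfl fun u _ => Finset.sum_congr rfl fun a _ => ?_
    exact congrArg f (appendSeq_cons a u x).symm

theorem transferOp_iterate_mul_comp {A : Type} [Fintype A] (n : ℕ) (f g : (ℕ → A) → ℝ) :
    transferOp^[n] (fun x => f x * g ((shiftMap A)^[n] x)) =
      fun x => transferOp^[n] f x * g x := by
  funext x
  simp only [transferOp_iterate_apply, shiftMap_iterate_appendSeq, Finset.sum_mul]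

theorem transferOp_iterate_mono {A : Type} [Fintype A] (n : ℕ) {f g : (ℕ → A) → ℝ}
    (h : ∀ x, f x ≤ g x) (x : ℕ → A) : transferOp^[n] f x ≤ transferOp^[n] g x := by
  simp only [transferOp_iterate_apply]
  exact Finset.sum_le_sum fun u _ => h _

theorem prefixWord_congr {A : Type} {t : ℕ} {x y : ℕ → A} (h : ∀ i ∈ Set.Iio t, x i = y i) :
    prefixWord t x = prefixWord t y :=
  funext fun i => h i i.isLt

theorem dependsOn_comp_prefixWord {A : Type} {β : Type*} (t : ℕ) (g : (Fin t → A) → β) :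
    DependsOn (fun x : ℕ → A => g (prefixWord t x)) (Set.Iio t) :=
  fun _ _ h => congrArg g (prefixWord_congr h)

theorem prefixProb_dependsOn {A : Type} [MeasurableSpace A] (μ : Measure (ℕ → A)) (t : ℕ) :
    DependsOn (prefixProb μ t) (Set.Iio t) :=
  dependsOn_comp_prefixWord (A := A) t (wordProb μ)

theorem dependsOn_comp_shiftMap_iterate {A β : Type} {f : (ℕ → A) → β} {t s n : ℕ}
    (hf : DependsOn f (Set.Iio t)) (h : t + n ≤ s) :
    DependsOn (fun x => f ((shiftMap A)^[n] x)) (Set.Iio s) := by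
  intro x y hxy
  refine hf fun i hi => ?_
  rw [shiftMap_iterate_apply, shiftMap_iterate_apply]
  exact hxy _ (by simp only [Set.mem_Iio] at *; omega)

theorem dependsOn_Iio_mono {A β : Type} {f : (ℕ → A) → β} {t s : ℕ}
    (hf : DependsOn f (Set.Iio t)) (h : t ≤ s) : DependsOn f (Set.Iio s) :=
  fun _ _ hxy => hf fun i hi => hxy i (lt_of_lt_of_le hi h)

theorem measurable_shiftMap (A : Type) [MeasurableSpace A] : Measurable (shiftMap A) :=
  measurable_pi_lambda _ fun n => measurable_pi_apply (n + 1)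

theorem measurable_prefixWord {A : Type} [MeasurableSpace A] (t : ℕ) :
    Measurable (prefixWord t : (ℕ → A) → Fin t → A) :=
  measurable_pi_lambda _ fun i => measurable_pi_apply i.val

section Discrete

variable {A : Type} [Fintype A] [MeasurableSpace A] [MeasurableSingletonClass A]

theorem measurable_of_dependsOn_Iio {f : (ℕ → A) → ℝ} {t : ℕ} (hf : DependsOn f (Set.Iio t)) :
    Measurable f := by
  rcases isEmpty_or_nonempty A with hA | ⟨⟨a⟩⟩
  · exact measurable_of_empty f
  · have : f = (fun u => f (appendSeq u fun _ => a)) ∘ prefixWord t :=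
      funext fun x => hf fun i hi => (appendSeq_prefixWord x _ hi).symm
    rw [this]
    exact (Measurable.of_discrete).comp (measurable_prefixWord t)

theorem measurable_prefixProb (μ : Measure (ℕ → A)) (t : ℕ) : Measurable (prefixProb μ t) :=
  measurable_of_dependsOn_Iio (prefixProb_dependsOn μ t)

variable (μ : Measure (ℕ → A)) [IsProbabilityMeasure μ]

theorem integral_comp_prefixWord (t : ℕ) (g : (Fin t → A) → ℝ) :
    Integrable (fun x => g (prefixWord t x)) μ ∧
      ∫ x, g (prefixWord t x) ∂μ = ∑ u, wordProb μ u * g u := by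
  have hm := measurable_prefixWord (A := A) t
  have : IsProbabilityMeasure (μ.map (prefixWord t)) :=
    Measure.isProbabilityMeasure_map hm.aemeasurable
  have hi : Integrable g (μ.map (prefixWord t)) := Integrable.of_finite
  refine ⟨hi.comp_measurable hm, ?_⟩
  rw [← integral_map hm.aemeasurable (Measurable.of_discrete.aestronglyMeasurable),
    integral_fintype hi]
  refine Finset.sum_congr rfl fun u _ => ?_
  rw [smul_eq_mul, measureReal_def, Measure.map_apply hm (measurableSet_singleton u), wordProb]
  congr 3
  ext x
  exact funext_iff

theorem integrable_of_dependsOn_Iio {f : (ℕ → A) → ℝ} {t : ℕ} (hf : DependsOn f (Set.Iio t)) :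
    Integrable f μ := by
  obtain ⟨y⟩ := nonempty_of_isProbabilityMeasure μ
  have : f = fun x => (fun u => f (appendSeq u y)) (prefixWord t x) :=
    funext fun x => hf fun i hi => (appendSeq_prefixWord x _ hi).symm
  rw [this]
  exact (integral_comp_prefixWord μ t fun u => f (appendSeq u y)).1

theorem integral_eq_transferOp {f : (ℕ → A) → ℝ} {t : ℕ} (hf : DependsOn f (Set.Iio t))
    (y : ℕ → A) : ∫ x, f x ∂μ = transferOp^[t] (fun x => prefixProb μ t x * f x) y := by
  have : f = fun x => (fun u => f (appendSeq u y)) (prefixWord t x) :=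
    funext fun x => hf fun i hi => (appendSeq_prefixWord x _ hi).symm
  conv_lhs => rw [this]
  rw [(integral_comp_prefixWord μ t _).2, transferOp_iterate_apply]
  simp only [prefixProb, prefixWord_appendSeq]

theorem transferOp_iterate_prefixProb (t : ℕ) :
    transferOp^[t] (prefixProb μ t) = fun _ => 1 := by
  funext y
  have := integral_eq_transferOp μ (f := fun _ => 1) (t := t) (fun _ _ _ => rfl) y
  simpa using this.symm

omit [Fintype A] [MeasurableSingletonClass A] [IsProbabilityMeasure μ] in
theorem prefixProb_nonneg (t : ℕ) (x : ℕ → A) : 0 ≤ prefixProb μ t x := ENNReal.toReal_nonneg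

omit [Fintype A] [MeasurableSingletonClass A] in
theorem prefixProb_le_one (t : ℕ) (x : ℕ → A) : prefixProb μ t x ≤ 1 := measureReal_le_one

omit [Fintype A] [MeasurableSingletonClass A] in
theorem prefixProb_zero (x : ℕ → A) : prefixProb μ 0 x = 1 := by
  simp [prefixProb, wordProb]

omit [Fintype A] [MeasurableSingletonClass A] in
theorem prefixProb_anti {s t : ℕ} (h : s ≤ t) (x : ℕ → A) :
    prefixProb μ t x ≤ prefixProb μ s x :=
  measureReal_mono fun _ hy i => hy (Fin.castLE h i)

omit [Fintype A] in
theorem measurableSet_cylinder {t : ℕ} (u : Fin t → A) :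
    MeasurableSet {x : ℕ → A | ∀ i : Fin t, x i.val = u i} := by
  have : {x : ℕ → A | ∀ i : Fin t, x i.val = u i} = prefixWord t ⁻¹' {u} := by
    ext x
    exact funext_iff.symm
  rw [this]
  exact measurable_prefixWord t (measurableSet_singleton u)

omit [Fintype A] in
theorem prefixProb_succ_le_shift (hμ : MeasurePreserving (shiftMap A) μ μ) (t : ℕ)
    (x : ℕ → A) : prefixProb μ (t + 1) x ≤ prefixProb μ t (shiftMap A x) := by
  have h := hμ.measureReal_preimage
    (measurableSet_cylinder (prefixWord t (shiftMap A x))).nullMeasurableSet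
  rw [prefixProb, prefixProb, wordProb, wordProb, ← measureReal_def, ← measureReal_def, ← h]
  exact measureReal_mono fun y hy i => hy i.succ

theorem ae_prefixProb_pos (t : ℕ) : ∀ᵐ x ∂μ, 0 < prefixProb μ t x := by
  obtain ⟨y⟩ := nonempty_of_isProbabilityMeasure μ
  have hdep : DependsOn (fun x => if 0 < prefixProb μ t x then (0 : ℝ) else 1) (Set.Iio t) :=
    fun _ _ h => by simp only [prefixProb_dependsOn μ t h]
  have h0 : ∫ x, (if 0 < prefixProb μ t x then (0 : ℝ) else 1) ∂μ = 0 := by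
    rw [integral_eq_transferOp μ hdep y, transferOp_iterate_apply]
    refine Finset.sum_eq_zero fun u _ => ?_
    split_ifs with h
    · simp
    · simp [le_antisymm (not_lt.1 h) (prefixProb_nonneg μ t _)]
  rw [integral_eq_zero_iff_of_nonneg (fun x => by positivity)
    (integrable_of_dependsOn_Iio μ hdep)] at h0
  filter_upwards [h0] with x hx
  by_contra h
  simp [h] at hx

theorem ae_forall_prefixProb_pos : ∀ᵐ x ∂μ, ∀ t, 0 < prefixProb μ t x :=
  ae_all_iff.2 (ae_prefixProb_pos μ)

omit [IsProbabilityMeasure μ] in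
theorem integral_comp_shiftMap (hμ : MeasurePreserving (shiftMap A) μ μ) {f : (ℕ → A) → ℝ}
    {t : ℕ} (hf : DependsOn f (Set.Iio t)) : ∫ x, f (shiftMap A x) ∂μ = ∫ x, f x ∂μ := by
  have h := integral_map (μ := μ) hμ.measurable.aemeasurable
    (measurable_of_dependsOn_Iio hf).aestronglyMeasurable
  rw [hμ.map_eq] at h
  exact h.symm

theorem transferOp_prefixProb_succ (hμ : MeasurePreserving (shiftMap A) μ μ) (t : ℕ) :
    transferOp (prefixProb μ (t + 1)) = prefixProb μ t := by
  classical
  funext y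
  have hdep : DependsOn (fun x => if prefixWord t x = prefixWord t y then (1 : ℝ) else 0)
      (Set.Iio t) :=
    dependsOn_comp_prefixWord t fun u => if u = prefixWord t y then (1 : ℝ) else 0
  have hdep' : DependsOn (fun x =>
      if prefixWord t (shiftMap A x) = prefixWord t y then (1 : ℝ) else 0) (Set.Iio (t + 1)) :=
    dependsOn_comp_shiftMap_iterate (n := 1) hdep le_rfl
  have h1 : ∫ x, (if prefixWord t (shiftMap A x) = prefixWord t y then (1 : ℝ) else 0) ∂μ =
      ∫ x, (if prefixWord t x = prefixWord t y then (1 : ℝ) else 0) ∂μ :=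
    integral_comp_shiftMap μ hμ hdep
  rw [integral_eq_transferOp μ hdep' y, integral_eq_transferOp μ hdep y,
    Function.iterate_succ_apply, transferOp_iterate_apply, transferOp_iterate_apply] at h1
  have hsum (F : (ℕ → A) → ℝ) (hF : DependsOn F (Set.Iio t)) :
      ∑ u : Fin t → A, (if u = prefixWord t y then F (appendSeq u y) else 0) = F y := by
    rw [Finset.sum_ite_eq' Finset.univ]
    simpa using hF fun i hi => appendSeq_prefixWord y y hi
  simp only [transferOp, shiftMap_consSeq, prefixWord_appendSeq, mul_ite, mul_one, mul_zero] at h1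
  rw [hsum _ (prefixProb_dependsOn μ t)] at h1
  rw [← h1, ← hsum (transferOp (prefixProb μ (t + 1)))]
  · refine Finset.sum_congr rfl fun u _ => ?_
    split_ifs <;> simp [transferOp]
  · intro x z hxz
    refine Finset.sum_congr rfl fun a _ => prefixProb_dependsOn μ (t + 1) fun i hi => ?_
    cases i with
    | zero => rfl
    | succ i => exact hxz i (Nat.lt_of_succ_lt_succ hi)

/-! ### Block entropies -/

/-- The entropy (in nats) of the first `t` letters. -/
noncomputable def blockEnt {A : Type} [MeasurableSpace A] (μ : Measure (ℕ → A)) (t : ℕ) : ℝ :=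
  ∫ x, -Real.log (prefixProb μ t x) ∂μ

omit [Fintype A] [MeasurableSingletonClass A] [IsProbabilityMeasure μ] in
theorem dependsOn_log_prefixProb (t : ℕ) :
    DependsOn (fun x => -Real.log (prefixProb μ t x)) (Set.Iio t) :=
  fun _ _ h => by simp only [prefixProb_dependsOn μ t h]

theorem blockEnt_eq_sum (t : ℕ) :
    blockEnt μ t = -∑ u : Fin t → A, wordProb μ u * Real.log (wordProb μ u) := by
  rw [blockEnt]
  refine (integral_comp_prefixWord μ t fun u => -Real.log (wordProb μ u)).2.trans ?_
  simp

theorem blockEnt_le_of_transferOp_le_one {t : ℕ} {q : (ℕ → A) → ℝ} (hq0 : ∀ x, 0 ≤ q x)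
    (hq : DependsOn q (Set.Iio t)) (hpq : ∀ x, q x = 0 → prefixProb μ t x = 0)
    (hsum : ∀ x, transferOp^[t] q x ≤ 1) : blockEnt μ t ≤ ∫ x, -Real.log (q x) ∂μ := by
  obtain ⟨y⟩ := nonempty_of_isProbabilityMeasure μ
  have hq' : DependsOn (fun x => -Real.log (q x)) (Set.Iio t) := fun _ _ h => by simp only [hq h]
  have h1 := congrFun (transferOp_iterate_prefixProb μ t) y
  have h2 := hsum y
  rw [blockEnt, integral_eq_transferOp μ hq' y,
    integral_eq_transferOp μ (dependsOn_log_prefixProb μ t) y]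
  simp only [transferOp_iterate_apply] at *
  have key : ∑ u : Fin t → A, (prefixProb μ t (appendSeq u y) *
        -Real.log (prefixProb μ t (appendSeq u y)) -
        prefixProb μ t (appendSeq u y) * -Real.log (q (appendSeq u y))) ≤
      ∑ u : Fin t → A, (q (appendSeq u y) - prefixProb μ t (appendSeq u y)) := by
    refine Finset.sum_le_sum fun u _ => ?_
    set x := appendSeq u y
    rcases (prefixProb_nonneg μ t x).eq_or_lt with h | h
    · simp [← h, hq0 x]
    · have hqx : 0 < q x := (hq0 x).lt_of_ne' fun h' => h.ne' (hpq x h')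
      have := Real.log_le_sub_one_of_pos (div_pos hqx h)
      rw [Real.log_div hqx.ne' h.ne'] at this
      have := mul_le_mul_of_nonneg_left this h.le
      have e : prefixProb μ t x * (q x / prefixProb μ t x - 1) = q x - prefixProb μ t x := by
        field_simp
      linarith
  rw [Finset.sum_sub_distrib, Finset.sum_sub_distrib] at key
  linarith

omit [Fintype A] [MeasurableSingletonClass A] in
theorem blockEnt_zero : blockEnt μ 0 = 0 := by simp [blockEnt, prefixProb_zero]

theorem blockEnt_mono (t : ℕ) : blockEnt μ t ≤ blockEnt μ (t + 1) := by
  refine integral_mono_ae (integrable_of_dependsOn_Iio μ (dependsOn_log_prefixProb μ t))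
    (integrable_of_dependsOn_Iio μ (dependsOn_log_prefixProb μ (t + 1))) ?_
  filter_upwards [ae_prefixProb_pos μ (t + 1)] with x hx
  exact neg_le_neg (Real.log_le_log hx (prefixProb_anti μ (Nat.le_succ t) x))

theorem blockEnt_diff_antitone (hμ : MeasurePreserving (shiftMap A) μ μ) (m : ℕ) :
    blockEnt μ (m + 2) - blockEnt μ (m + 1) ≤ blockEnt μ (m + 1) - blockEnt μ m := by
  have hp := prefixProb_nonneg μ
  have hd := prefixProb_dependsOn μ
  let g : (ℕ → A) → ℝ := fun x => prefixProb μ (m + 1) x / prefixProb μ m x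
  have hg : DependsOn g (Set.Iio (m + 1)) := fun x y h => by
    simp only [g, hd (m + 1) h, dependsOn_Iio_mono (hd m) (Nat.le_succ m) h]
  have hle := blockEnt_le_of_transferOp_le_one μ (t := m + 2)
    (q := fun x => prefixProb μ (m + 1) x * g (shiftMap A x))
    (fun x => mul_nonneg (hp _ _) (div_nonneg (hp _ _) (hp _ _)))
    (fun x y h => by
      have := dependsOn_comp_shiftMap_iterate (n := 1) hg le_rfl h
      simp only [Function.iterate_one] at this
      simp only [dependsOn_Iio_mono (hd (m + 1)) (Nat.le_succ _) h, this])
    (fun x hx => by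
      refine le_antisymm ?_ (hp _ _)
      rcases mul_eq_zero.1 hx with h | h
      · exact h ▸ prefixProb_anti μ (Nat.le_succ _) x
      · have h3 := prefixProb_succ_le_shift μ hμ (m + 1) x
        rcases div_eq_zero_iff.1 h with h | h
        · exact h ▸ h3
        · exact h3.trans (h ▸ prefixProb_anti μ (Nat.le_succ m) (shiftMap A x)))
    (fun x => by
      have e := transferOp_iterate_mul_comp 1 (prefixProb μ (m + 1)) g
      simp only [Function.iterate_one, transferOp_prefixProb_succ μ hμ] at e
      rw [Function.iterate_succ_apply, e]
      calc _ ≤ transferOp^[m + 1] (prefixProb μ (m + 1)) x := by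
            refine transferOp_iterate_mono _ (fun z => ?_) x
            rcases (hp m z).eq_or_lt with h | h
            · simp [← h, hp]
            · simp only [g]
              rw [mul_div_cancel₀ _ h.ne']
        _ = 1 := congrFun (transferOp_iterate_prefixProb μ (m + 1)) x)
  have hi (t : ℕ) := integrable_of_dependsOn_Iio μ (dependsOn_log_prefixProb μ t)
  have hs (t : ℕ) : ∫ x, -Real.log (prefixProb μ t (shiftMap A x)) ∂μ = blockEnt μ t :=
    integral_comp_shiftMap μ hμ (dependsOn_log_prefixProb μ t)
  have his (t : ℕ) : Integrable (fun x => -Real.log (prefixProb μ t (shiftMap A x))) μ :=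
    hμ.integrable_comp_of_integrable (hi t)
  have heq : ∫ x, -Real.log (prefixProb μ (m + 1) x * g (shiftMap A x)) ∂μ =
      blockEnt μ (m + 1) + blockEnt μ (m + 1) - blockEnt μ m := by
    have hpos := hμ.quasiMeasurePreserving.ae (ae_forall_prefixProb_pos μ)
    rw [← hs m]
    conv_rhs => enter [1, 2]; rw [← hs (m + 1)]
    rw [blockEnt, ← integral_add (hi _) (his _),
      ← integral_sub (f := fun x => _ + _) ((hi _).add (his _)) (his _)]
    refine integral_congr_ae ?_
    filter_upwards [hpos, ae_prefixProb_pos μ (m + 1)] with x hx hx'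
    simp only [g]
    rw [Real.log_mul hx'.ne' (div_pos (hx _) (hx _)).ne',
      Real.log_div (hx _).ne' (hx _).ne']
    ring
  linarith

theorem sum_wordProb_snoc {m : ℕ} (v : Fin m → A) :
    ∑ a : A, wordProb μ (Fin.snoc v a : Fin (m + 1) → A) = wordProb μ v := by
  classical
  have h1 := (integral_comp_prefixWord μ m fun u => if u = v then (1 : ℝ) else 0).2
  have h2 := (integral_comp_prefixWord μ (m + 1)
    fun u => if Fin.init u = v then (1 : ℝ) else 0).2
  rw [← (Fin.snocEquiv fun _ : Fin (m + 1) => A).sum_comp, Fintype.sum_prod_type_right] at h2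
  have h3 (x : ℕ → A) : Fin.init (prefixWord (m + 1) x) = prefixWord m x := rfl
  have h4 (u : Fin m → A) (a : A) :
      (Fin.snocEquiv fun _ : Fin (m + 1) => A) (a, u) = Fin.snoc u a := rfl
  simp only [h3, h1, h4, Fin.init_snoc, mul_ite, mul_one, mul_zero] at h2
  simpa [Finset.sum_ite_irrel] using h2.symm

theorem condEnt_eq_blockEnt_sub (m : ℕ) :
    condEnt μ m = (blockEnt μ (m + 1) - blockEnt μ m) / Real.log 2 := by
  have h0 {n : ℕ} (u : Fin n → A) : 0 ≤ wordProb μ u := ENNReal.toReal_nonneg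
  rw [blockEnt_eq_sum, blockEnt_eq_sum, condEnt,
    ← (Fin.snocEquiv fun _ : Fin (m + 1) => A).sum_comp, Fintype.sum_prod_type_right]
  have hsnoc (u : Fin m → A) (a : A) :
      (Fin.snocEquiv fun _ : Fin (m + 1) => A) (a, u) = Fin.snoc u a := rfl
  simp only [hsnoc]
  rw [eq_div_iff (Real.log_pos one_lt_two).ne', neg_mul, Finset.sum_mul, neg_sub_neg,
    ← neg_sub, neg_inj, ← Finset.sum_sub_distrib]
  refine Finset.sum_congr rfl fun v _ => ?_
  conv_rhs => rw [← sum_wordProb_snoc μ v]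
  rw [Finset.sum_mul, ← Finset.sum_sub_distrib, Finset.mul_sum, Finset.sum_mul]
  refine Finset.sum_congr rfl fun a _ => ?_
  rw [sum_wordProb_snoc μ v]
  have hle : wordProb μ (Fin.snoc v a : Fin (m + 1) → A) ≤ wordProb μ v := by
    rw [← sum_wordProb_snoc μ v]
    exact Finset.single_le_sum (f := fun a => wordProb μ (Fin.snoc v a : Fin (m + 1) → A))
      (fun _ _ => h0 _) (Finset.mem_univ a)
  rcases (h0 (Fin.snoc v a : Fin (m + 1) → A)).eq_or_lt with h | h
  · simp [← h]
  · have hv := h.trans_le hle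
    rw [Real.logb, Real.log_div h.ne' hv.ne']
    field_simp [(Real.log_pos one_lt_two).ne']

theorem tendsto_condEnt (hμ : MeasurePreserving (shiftMap A) μ μ) :
    Tendsto (condEnt μ) atTop (nhds (entRate μ)) := by
  have hlog := Real.log_pos one_lt_two
  have hanti : Antitone (condEnt μ) := antitone_nat_of_succ_le fun m => by
    rw [condEnt_eq_blockEnt_sub, condEnt_eq_blockEnt_sub]
    exact div_le_div_of_nonneg_right (blockEnt_diff_antitone μ hμ m) hlog.le
  have hbdd : BddBelow (Set.range (condEnt μ)) := ⟨0, by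
    rintro _ ⟨m, rfl⟩
    rw [condEnt_eq_blockEnt_sub]
    exact div_nonneg (sub_nonneg.2 (blockEnt_mono μ m)) hlog.le⟩
  exact tendsto_nhds_limUnder ⟨_, tendsto_atTop_ciInf hanti hbdd⟩

theorem tendsto_blockEnt_div (hμ : MeasurePreserving (shiftMap A) μ μ) :
    Tendsto (fun t : ℕ => (t : ℝ)⁻¹ * blockEnt μ t) atTop
      (nhds (entRate μ * Real.log 2)) := by
  have h := ((tendsto_condEnt μ hμ).mul_const (Real.log 2)).cesaro
  refine h.congr fun t => ?_
  have hlog := (Real.log_pos one_lt_two).ne'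
  simp only [condEnt_eq_blockEnt_sub, div_mul_cancel₀ _ hlog, Finset.sum_range_sub,
    blockEnt_zero, sub_zero]

/-! ### A mixture over parsings into blocks -/

/-- The mixture over parsings of the first `t` letters: a block of length `n + 1` has weight
`w n` times its probability, and a single letter may also be emitted with weight `κ`. -/
noncomputable def parseMix {A : Type} [MeasurableSpace A] (μ : Measure (ℕ → A)) (w : ℕ → ℝ)
    (κ : ℝ) : ℕ → (ℕ → A) → ℝ
  | 0, _ => 1
  | t + 1, x => κ * parseMix μ w κ t (shiftMap A x) +
      ∑ n : Fin (t + 1), w n * (prefixProb μ (n + 1) x *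
        parseMix μ w κ (t - n) ((shiftMap A)^[n + 1] x))

omit [Fintype A] [MeasurableSingletonClass A] [IsProbabilityMeasure μ] in
theorem parseMix_dependsOn (w : ℕ → ℝ) (κ : ℝ) (t : ℕ) :
    DependsOn (parseMix μ w κ t) (Set.Iio t) := by
  induction t using Nat.strong_induction_on with
  | _ t ih =>
    cases t with
    | zero => exact fun x y _ => by simp [parseMix]
    | succ t =>
      intro x y h
      have h1 := dependsOn_comp_shiftMap_iterate (n := 1) (ih t (Nat.lt_succ_self t)) le_rfl h
      simp only [Function.iterate_one] at h1
      rw [parseMix, parseMix, h1]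
      congr 1
      refine Finset.sum_congr rfl fun n _ => ?_
      have hn := n.isLt
      have h2 := dependsOn_comp_shiftMap_iterate (n := n + 1) (s := t + 1)
        (ih (t - n) (by omega)) (by omega) h
      simp only at h2
      rw [dependsOn_Iio_mono (prefixProb_dependsOn μ (n + 1)) (by omega) h, h2]

theorem transferOp_iterate_parseMix_le {w : ℕ → ℝ} {κ : ℝ} (hw : ∀ n, 0 ≤ w n) (hκ : 0 ≤ κ)
    (hsum : ∀ t, κ * Fintype.card A + ∑ n ∈ Finset.range t, w n ≤ 1) (t : ℕ) (x : ℕ → A) :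
    transferOp^[t] (parseMix μ w κ t) x ≤ 1 := by
  induction t using Nat.strong_induction_on with
  | _ t ih =>
    cases t with
    | zero => simp [parseMix]
    | succ t =>
      have h1 : transferOp^[t + 1] (fun y => parseMix μ w κ t (shiftMap A y)) x =
          Fintype.card A * transferOp^[t] (parseMix μ w κ t) x := by
        have : transferOp (fun y => parseMix μ w κ t (shiftMap A y)) =
            fun y => Fintype.card A * parseMix μ w κ t y := by
          funext y
          simp [transferOp, shiftMap_consSeq]
        rw [Function.iterate_succ_apply, this, transferOp_iterate_apply,
          transferOp_iterate_apply, Finset.mul_sum]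
      have h2 (n : Fin (t + 1)) : transferOp^[t + 1] (fun y => prefixProb μ (n + 1) y *
          parseMix μ w κ (t - n) ((shiftMap A)^[n + 1] y)) x =
          transferOp^[t - n] (parseMix μ w κ (t - n)) x := by
        obtain ⟨n, hn⟩ := n
        simp only
        rw [show t + 1 = (t - n) + (n + 1) by omega, Function.iterate_add_apply, transferOp_iterate_mul_comp,
          transferOp_iterate_prefixProb]
        simp only [one_mul]
      have h3 : transferOp^[t + 1] (parseMix μ w κ (t + 1)) x =
          κ * (Fintype.card A * transferOp^[t] (parseMix μ w κ t) x) +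
            ∑ n : Fin (t + 1), w n * transferOp^[t - n] (parseMix μ w κ (t - n)) x := by
        rw [← h1]
        simp only [← h2]
        simp only [transferOp_iterate_apply, parseMix, Finset.sum_add_distrib, Finset.mul_sum]
        rw [Finset.sum_comm (s := (Finset.univ : Finset (Fin (t + 1))))]
      rw [h3]
      refine le_trans (add_le_add (mul_le_mul_of_nonneg_left (mul_le_of_le_one_right
        (Nat.cast_nonneg _) (ih t (Nat.lt_succ_self t))) hκ) (Finset.sum_le_sum fun n _ =>
          mul_le_of_le_one_right (hw n) (ih (t - n) (by omega)))) ?_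
      rw [Fin.sum_univ_eq_sum_range]
      exact hsum (t + 1)

omit [Fintype A] [MeasurableSingletonClass A] [IsProbabilityMeasure μ] in
theorem parseMix_nonneg {w : ℕ → ℝ} {κ : ℝ} (hw : ∀ n, 0 ≤ w n) (hκ : 0 ≤ κ) (t : ℕ)
    (x : ℕ → A) : 0 ≤ parseMix μ w κ t x := by
  induction t using Nat.strong_induction_on generalizing x with
  | _ t ih =>
    cases t with
    | zero => simp [parseMix]
    | succ t =>
      rw [parseMix]
      exact add_nonneg (mul_nonneg hκ (ih t (Nat.lt_succ_self t) _))
        (Finset.sum_nonneg fun n _ => mul_nonneg (hw n) (mul_nonneg (prefixProb_nonneg μ _ _)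
          (ih (t - n) (by omega) _)))

/-- The sequences none of whose prefixes of length between `N` and `M` has probability at least
`exp (-c)` per letter. -/
def sparseSet {A : Type} [MeasurableSpace A] (μ : Measure (ℕ → A)) (c : ℝ) (N M : ℕ) :
    Set (ℕ → A) :=
  {x | ∀ n, N ≤ n → n ≤ M → prefixProb μ n x < Real.exp (-(n * c))}

omit [IsProbabilityMeasure μ] in
theorem measurableSet_sparseSet (c : ℝ) (N M : ℕ) : MeasurableSet (sparseSet μ c N M) := by
  refine measurableSet_setOfPred.2 (Measurable.forall fun n => Measurable.forall fun _ =>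
    Measurable.forall fun _ => measurableSet_setOfPred.1 ?_)
  exact measurableSet_lt (measurable_prefixProb μ n) measurable_const

omit [Fintype A] [MeasurableSingletonClass A] [IsProbabilityMeasure μ] in
theorem exp_le_parseMix {w : ℕ → ℝ} {K c δ : ℝ} {N M : ℕ} (hN : 1 ≤ N) (hK : 0 ≤ K)
    (hc : 0 ≤ c + δ) (hw : ∀ n, 0 ≤ w n)
    (hwN : ∀ n : ℕ, N ≤ n + 1 → Real.exp (-((n + 1 : ℕ) * δ)) ≤ w n) (t : ℕ) (x : ℕ → A) :
    Real.exp (-((c + δ) * t + K * ∑ i ∈ Finset.range t,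
      (sparseSet μ c N M).indicator 1 ((shiftMap A)^[i] x) + K * (min t M : ℕ))) ≤
      parseMix μ w (Real.exp (-K)) t x := by
  set B := sparseSet μ c N M with hB
  have hI (y : ℕ → A) : (0 : ℝ) ≤ B.indicator 1 y := Set.indicator_nonneg (fun _ _ => zero_le_one) y
  have hmix := parseMix_nonneg μ hw (Real.exp_nonneg (-K))
  induction t using Nat.strong_induction_on generalizing x with
  | _ t ih =>
    cases t with
    | zero => simp [parseMix]
    | succ t =>
      by_cases hgood : ∃ n, N ≤ n ∧ n ≤ t + 1 ∧ Real.exp (-(n * c)) ≤ prefixProb μ n x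
      · obtain ⟨n, hn1, hn2, hn3⟩ := hgood
        obtain ⟨k, rfl⟩ : ∃ k, n = k + 1 := ⟨n - 1, by omega⟩
        obtain ⟨s, rfl⟩ : ∃ s, t = k + s := ⟨t - k, by omega⟩
        have h1 : w k * (prefixProb μ (k + 1) x *
            parseMix μ w (Real.exp (-K)) s ((shiftMap A)^[k + 1] x)) ≤
            parseMix μ w (Real.exp (-K)) (k + s + 1) x := by
          rw [parseMix]
          refine le_add_of_nonneg_of_le (mul_nonneg (Real.exp_nonneg _) (hmix _ _)) ?_
          have := Finset.single_le_sum (f := fun n : Fin (k + s + 1) => w n *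
            (prefixProb μ (n + 1) x *
              parseMix μ w (Real.exp (-K)) (k + s - n) ((shiftMap A)^[n + 1] x)))
            (fun n _ => mul_nonneg (hw n) (mul_nonneg (prefixProb_nonneg μ _ _) (hmix _ _)))
            (Finset.mem_univ ⟨k, by omega⟩)
          simpa using this
        refine le_trans ?_ h1
        refine le_trans ?_ (mul_le_mul (hwN k hn1) (mul_le_mul hn3
          (ih s (by omega) _) (Real.exp_nonneg _) (prefixProb_nonneg μ _ _)) (by positivity)
          (hw k))
        rw [← Real.exp_add, ← Real.exp_add, Real.exp_le_exp]
        have h2 : ∑ i ∈ Finset.range s, B.indicator (1 : (ℕ → A) → ℝ)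
            ((shiftMap A)^[i] ((shiftMap A)^[k + 1] x)) ≤
            ∑ i ∈ Finset.range (k + s + 1), B.indicator 1 ((shiftMap A)^[i] x) := by
          rw [show k + s + 1 = (k + 1) + s by ring, Finset.sum_range_add]
          refine le_add_of_nonneg_of_le (Finset.sum_nonneg fun _ _ => hI _)
            (Finset.sum_le_sum fun i _ => ?_)
          rw [← Function.iterate_add_apply, add_comm i]
        have h3 : ((min s M : ℕ) : ℝ) ≤ (min (k + s + 1) M : ℕ) := by
          exact_mod_cast min_le_min_right M (by omega)
        have h4 := mul_le_mul_of_nonneg_left h2 hK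
        have h5 := mul_le_mul_of_nonneg_left h3 hK
        push_cast at h4 h5 ⊢
        nlinarith
      · push Not at hgood
        have h1 : Real.exp (-K) * parseMix μ w (Real.exp (-K)) t (shiftMap A x) ≤
            parseMix μ w (Real.exp (-K)) (t + 1) x := by
          rw [parseMix]
          exact le_add_of_nonneg_right (Finset.sum_nonneg fun n _ =>
            mul_nonneg (hw n) (mul_nonneg (prefixProb_nonneg μ _ _) (hmix _ _)))
        refine le_trans ?_ h1
        refine le_trans ?_ (mul_le_mul_of_nonneg_left (ih t (Nat.lt_succ_self t) _)
          (Real.exp_nonneg _))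
        rw [← Real.exp_add, Real.exp_le_exp, Finset.sum_range_succ']
        simp only [Function.iterate_succ_apply, Function.iterate_zero, id]
        have h2 : (1 : ℝ) + (min t M : ℕ) ≤ B.indicator 1 x + (min (t + 1) M : ℕ) := by
          rcases Nat.lt_or_ge t M with h | h
          · rw [min_eq_left h.le, min_eq_left (Nat.succ_le_of_lt h)]
            push_cast
            linarith [hI x]
          · have hx : x ∈ B := fun n hn1 hn2 => hgood n hn1 (by omega)
            rw [min_eq_right h, min_eq_right (by omega), Set.indicator_of_mem hx]
            simp
        have h3 := mul_le_mul_of_nonneg_left h2 hK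
        push_cast at h3 ⊢
        nlinarith

theorem blockEnt_le_sparseSet (hμ : MeasurePreserving (shiftMap A) μ μ) {w : ℕ → ℝ}
    {K c δ : ℝ} {N : ℕ} (hN : 1 ≤ N) (hK : 0 ≤ K) (hc : 0 ≤ c + δ) (hw : ∀ n, 0 ≤ w n)
    (hwN : ∀ n : ℕ, N ≤ n + 1 → Real.exp (-((n + 1 : ℕ) * δ)) ≤ w n)
    (hsum : ∀ t, Real.exp (-K) * Fintype.card A + ∑ n ∈ Finset.range t, w n ≤ 1) (M t : ℕ) :
    blockEnt μ t ≤ (c + δ) * t + K * (t * μ.real (sparseSet μ c N M)) + K * M := by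
  have hlow := exp_le_parseMix μ (M := M) hN hK hc hw hwN t
  have hpos (x : ℕ → A) : 0 < parseMix μ w (Real.exp (-K)) t x :=
    (Real.exp_pos _).trans_le (hlow x)
  have hdep := parseMix_dependsOn μ w (Real.exp (-K)) t
  have hdep' : DependsOn (fun x => -Real.log (parseMix μ w (Real.exp (-K)) t x)) (Set.Iio t) :=
    fun _ _ h => by simp only [hdep h]
  have hBm := measurableSet_sparseSet μ c N M
  set B := sparseSet μ c N M
  have hind : Integrable (B.indicator (1 : (ℕ → A) → ℝ)) μ :=
    (integrable_const (1 : ℝ)).indicator hBm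
  have hiter (i : ℕ) : Integrable (fun x => B.indicator (1 : (ℕ → A) → ℝ)
      ((shiftMap A)^[i] x)) μ := (hμ.iterate i).integrable_comp_of_integrable hind
  have hval (i : ℕ) : ∫ x, B.indicator (1 : (ℕ → A) → ℝ) ((shiftMap A)^[i] x) ∂μ =
      μ.real B := by
    have h := integral_map (μ := μ) (hμ.iterate i).measurable.aemeasurable
      (f := B.indicator (1 : (ℕ → A) → ℝ)) (measurable_one.indicator hBm).aestronglyMeasurable
    rw [(hμ.iterate i).map_eq, integral_indicator_one hBm] at h
    exact h.symm
  calc blockEnt μ t ≤ ∫ x, -Real.log (parseMix μ w (Real.exp (-K)) t x) ∂μ :=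
        blockEnt_le_of_transferOp_le_one μ (fun x => (hpos x).le) hdep
          (fun x h => absurd h (hpos x).ne')
          (transferOp_iterate_parseMix_le μ hw (Real.exp_nonneg _) hsum t)
    _ ≤ ∫ x, ((c + δ) * t + K * M + K * ∑ i ∈ Finset.range t,
          B.indicator 1 ((shiftMap A)^[i] x)) ∂μ := by
        refine integral_mono (integrable_of_dependsOn_Iio μ hdep')
          ((integrable_const _).add ((integrable_finsetSum _ fun i _ => hiter i).const_mul K))
          fun x => ?_
        have h1 := Real.log_le_log (Real.exp_pos _) (hlow x)
        rw [Real.log_exp] at h1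
        have h2 : ((min t M : ℕ) : ℝ) ≤ M := by exact_mod_cast min_le_right t M
        have h3 := mul_le_mul_of_nonneg_left h2 hK
        simp only
        linarith
    _ = _ := by
        rw [integral_add (integrable_const _)
          ((integrable_finsetSum _ fun i _ => hiter i).const_mul K), integral_const_mul,
          integral_finsetSum _ fun i _ => hiter i]
        simp only [hval]
        simp
        ring

theorem entRate_le_of_ae_frequently (hμ : MeasurePreserving (shiftMap A) μ μ) {c : ℝ}
    (hc : 0 ≤ c)
    (h : ∀ᵐ x ∂μ, ∃ᶠ n : ℕ in atTop, Real.exp (-(n * c)) ≤ prefixProb μ n x) :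
    entRate μ * Real.log 2 ≤ c := by
  obtain ⟨y⟩ := nonempty_of_isProbabilityMeasure μ
  have hA : Nonempty A := ⟨y 0⟩
  have hcard : (1 : ℝ) ≤ Fintype.card A := by exact_mod_cast Fintype.card_pos
  refine le_of_forall_pos_le_add fun δ hδ => ?_
  set r := Real.exp (-(δ / 2)) with hr
  have hr0 : 0 < r := Real.exp_pos _
  have hr1 : r < 1 := Real.exp_lt_one_iff.2 (by linarith)
  set K := Real.log (2 * Fintype.card A) with hKdef
  have hK : 0 ≤ K := Real.log_nonneg (by linarith)
  set w : ℕ → ℝ := fun n => (1 - r) / 2 * r ^ n with hwdef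
  have hw (n : ℕ) : 0 ≤ w n := mul_nonneg (by linarith) (by positivity)
  have hsum (t : ℕ) : Real.exp (-K) * Fintype.card A + ∑ n ∈ Finset.range t, w n ≤ 1 := by
    have e1 : Real.exp (-K) * Fintype.card A = 1 / 2 := by
      rw [hKdef, Real.exp_neg, Real.exp_log (by linarith)]
      field_simp
    have e2 : ∑ n ∈ Finset.range t, w n = (1 - r ^ t) / 2 := by
      have := geom_sum_mul_neg r t
      rw [hwdef, ← Finset.mul_sum, ← this]
      ring
    have : 0 < r ^ t := by positivity
    rw [e1, e2]
    linarith
  obtain ⟨N, hN⟩ := eventually_atTop.1 ((tendsto_pow_atTop_nhds_zero_of_lt_one hr0.le hr1).eventually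
    (ge_mem_nhds (show 0 < (1 - r) / 2 by linarith)))
  have hwN (n : ℕ) (hn : max N 1 ≤ n + 1) : Real.exp (-((n + 1 : ℕ) * δ)) ≤ w n := by
    have e : Real.exp (-((n + 1 : ℕ) * δ)) = r ^ (n + 1) * r ^ (n + 1) := by
      rw [← pow_add, hr, ← Real.exp_nat_mul]
      congr 1
      push_cast
      ring
    rw [e]
    exact mul_le_mul (hN _ (le_trans (le_max_left _ _) hn))
      (pow_le_pow_of_le_one hr0.le hr1.le (Nat.le_succ n)) (by positivity) (by linarith)
  have hbound (M : ℕ) : entRate μ * Real.log 2 ≤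
      c + δ + K * μ.real (sparseSet μ c (max N 1) M) := by
    have hlim : Tendsto (fun t : ℕ => (c + δ + K * μ.real (sparseSet μ c (max N 1) M)) +
        K * M * (t : ℝ)⁻¹) atTop
        (nhds ((c + δ + K * μ.real (sparseSet μ c (max N 1) M)) + K * M * 0)) :=
      (tendsto_inv_atTop_nhds_zero_nat.const_mul _).const_add _
    rw [mul_zero, add_zero] at hlim
    refine le_of_tendsto_of_tendsto (tendsto_blockEnt_div μ hμ) hlim ?_
    filter_upwards [eventually_gt_atTop 0] with t ht
    have ht' : (0 : ℝ) < t := by exact_mod_cast ht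
    have := blockEnt_le_sparseSet μ hμ (c := c) (le_max_right N 1) hK (by linarith) hw hwN hsum M t
    rw [inv_mul_le_iff₀ ht']
    refine this.trans_eq ?_
    field_simp
  have hzero : Tendsto (fun M => μ.real (sparseSet μ c (max N 1) M)) atTop (nhds 0) := by
    have h1 := tendsto_measure_iInter_atTop (μ := μ) (s := sparseSet μ c (max N 1))
      (fun M => (measurableSet_sparseSet μ c _ M).nullMeasurableSet)
      (fun M M' hM x hx n h1 h2 => hx n h1 (h2.trans hM)) ⟨0, measure_ne_top _ _⟩
    have h2 : μ (⋂ M, sparseSet μ c (max N 1) M) = 0 := by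
      refine measure_mono_null (fun x hx => ?_) h
      simp only [Set.mem_compl_iff, Set.mem_ofPred_eq, not_frequently]
      filter_upwards [eventually_ge_atTop (max N 1)] with n hn
      exact not_le.2 (Set.mem_iInter.1 hx n n hn le_rfl)
    rw [h2] at h1
    exact (ENNReal.tendsto_toReal ENNReal.zero_ne_top).comp h1
  refine ge_of_tendsto' (x := atTop) ?_ hbound
  simpa using (hzero.const_mul K).const_add (c + δ)

theorem ae_eventually_prefixProb_lt (hμ : Ergodic (shiftMap A) μ) {c : ℝ}
    (hc : c < entRate μ * Real.log 2) :
    ∀ᵐ x ∂μ, ∀ᶠ n : ℕ in atTop, prefixProb μ n x < Real.exp (-(n * c)) := by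
  rcases lt_or_ge c 0 with hneg | hc0
  · refine ae_of_all _ fun x => ?_
    filter_upwards [eventually_gt_atTop 0] with n hn
    have hn' : (0 : ℝ) < n := by exact_mod_cast hn
    refine (prefixProb_le_one μ n x).trans_lt (Real.one_lt_exp_iff.2 ?_)
    nlinarith
  obtain ⟨c', hcc', hc'⟩ := exists_between hc
  let D : Set (ℕ → A) :=
    {x | ∃ k : ℕ, ∃ᶠ n : ℕ in atTop, Real.exp (-(n * c + k)) ≤ prefixProb μ n x}
  have hDm : MeasurableSet D := by
    simp only [D, frequently_atTop]
    refine measurableSet_setOfPred.2 (Measurable.exists fun k => Measurable.forall fun a =>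
      Measurable.exists fun b => Measurable.and measurable_const (measurableSet_setOfPred.1 ?_))
    exact measurableSet_le measurable_const (measurable_prefixProb μ b)
  have hDsub : D ⊆ shiftMap A ⁻¹' D := by
    rintro x ⟨k, hk⟩
    obtain ⟨j, hj⟩ := exists_nat_ge c
    refine ⟨k + j, ?_⟩
    rw [frequently_atTop] at hk ⊢
    intro a
    obtain ⟨b, hb, hb'⟩ := hk (a + 1)
    obtain ⟨b, rfl⟩ : ∃ b', b = b' + 1 := ⟨b - 1, by omega⟩
    refine ⟨b, by omega, le_trans ?_ (hb'.trans
      (prefixProb_succ_le_shift μ hμ.toMeasurePreserving b x))⟩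
    rw [Real.exp_le_exp]
    push_cast
    linarith
  rcases hμ.ae_empty_or_univ_of_ae_le_preimage hDm.nullMeasurableSet hDsub.eventuallyLE with h | h
  · filter_upwards [eventuallyEq_empty.1 h] with x hx
    simp only [D, Set.mem_ofPred_eq, not_exists, not_frequently, not_le] at hx
    simpa using hx 0
  · exfalso
    refine absurd (entRate_le_of_ae_frequently μ hμ.toMeasurePreserving (hc0.trans hcc'.le) ?_)
      (not_le.2 hc')
    filter_upwards [eventuallyEq_univ.1 h] with x hx
    obtain ⟨k, hk⟩ := hx
    have hev : ∀ᶠ n : ℕ in atTop, (k : ℝ) ≤ n * (c' - c) :=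
      (tendsto_natCast_atTop_atTop.atTop_mul_const (sub_pos.2 hcc')).eventually_ge_atTop _
    refine (hk.and_eventually hev).mono fun n hn => le_trans ?_ hn.1
    rw [Real.exp_le_exp]
    linarith [hn.2]

/-! ### Comparison with sub-probability assignments -/

theorem ae_eventually_le_sq_mul_prefixProb {q : ℕ → (ℕ → A) → ℝ} (hq0 : ∀ t x, 0 ≤ q t x)
    (hq : ∀ t, DependsOn (q t) (Set.Iio t)) (hsum : ∀ t x, transferOp^[t] (q t) x ≤ 1) :
    ∀ᵐ x ∂μ, ∀ᶠ t : ℕ in atTop, q t x ≤ (t : ℝ) ^ 2 * prefixProb μ t x := by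
  classical
  obtain ⟨y⟩ := nonempty_of_isProbabilityMeasure μ
  let S : ℕ → Set (ℕ → A) := fun t => {x | (t : ℝ) ^ 2 * prefixProb μ t x < q t x}
  have hSm (t : ℕ) : MeasurableSet (S t) :=
    measurableSet_lt ((measurable_prefixProb μ t).const_mul _) (measurable_of_dependsOn_Iio (hq t))
  have hS (t : ℕ) : μ.real (S t) ≤ 1 / (t : ℝ) ^ 2 ∨ t = 0 := by
    rcases Nat.eq_zero_or_pos t with ht | ht
    · exact .inr ht
    left
    have ht' : (0 : ℝ) < t := by exact_mod_cast ht
    have hdep : DependsOn ((S t).indicator (1 : (ℕ → A) → ℝ)) (Set.Iio t) := fun x z h => by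
      simp only [Set.indicator, S, Set.mem_ofPred_eq, hq t h, prefixProb_dependsOn μ t h,
        Pi.one_apply]
    rw [← integral_indicator_one (hSm t), integral_eq_transferOp μ hdep y, le_div_iff₀ (by positivity)]
    refine le_trans ?_ (hsum t y)
    rw [transferOp_iterate_apply, transferOp_iterate_apply, Finset.sum_mul]
    refine Finset.sum_le_sum fun u _ => ?_
    by_cases hu : appendSeq u y ∈ S t
    · rw [Set.indicator_of_mem hu]
      have := le_of_lt (Set.mem_ofPred_eq ▸ hu)
      simp only [Pi.one_apply, mul_one]
      linarith
    · rw [Set.indicator_of_notMem hu]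
      simpa using hq0 t _
  have hfin : ∑' t, μ (S t) ≠ ⊤ := by
    have hs : Summable fun t => μ.real (S t) := by
      refine Summable.of_norm_bounded_eventually_nat
        (Real.summable_one_div_nat_pow.2 one_lt_two) ?_
      filter_upwards [eventually_gt_atTop 0] with t ht
      rw [Real.norm_of_nonneg measureReal_nonneg]
      exact (hS t).resolve_right ht.ne'
    have := hs.tsum_ofReal_ne_top
    simpa using this
  filter_upwards [ae_eventually_notMem hfin] with x hx
  filter_upwards [hx] with t ht
  exact not_lt.1 ht

end Discrete

/-! ### Codes -/

theorem UDCode.enc_injective {A : Type} (U : UDCode A) (t : ℕ) :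
    Function.Injective (U.enc t) := by
  intro u v h
  have := U.ud t (a₁ := [u]) (a₂ := [v]) (by simp [h])
  simpa using this

theorem UDCode.kraft_sum_le_one {A : Type} [Fintype A] (U : UDCode A) (t : ℕ) :
    ∑ u : Fin t → A, (2 : ℝ) ^ (-((U.enc t u).length : ℤ)) ≤ 1 := by
  classical
  have hS : InformationTheory.UniquelyDecodable
      ((Finset.univ.image (U.enc t) : Finset (List Bool)) : Set (List Bool)) := by
    have hex (L : List (List Bool))
        (hL : ∀ w ∈ L, w ∈ ((Finset.univ.image (U.enc t) : Finset (List Bool)) :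
          Set (List Bool))) : ∃ l, List.map (U.enc t) l = L := by
      have : L ∈ Set.range (List.map (U.enc t)) := by
        rw [Set.range_list_map]
        intro w hw
        simpa using hL w hw
      exact this
    intro L₁ L₂ h₁ h₂ h
    obtain ⟨l₁, rfl⟩ := hex L₁ h₁
    obtain ⟨l₂, rfl⟩ := hex L₂ h₂
    exact congrArg _ (U.ud t h)
  have h := InformationTheory.kraft_mcmillan_inequality hS
  rw [Finset.sum_image fun u _ v _ huv => U.enc_injective t huv] at h
  simpa using h

/-- The restriction of a code to a subalphabet. -/
def UDCode.comap {A B : Type} (U : UDCode A) (φ : B → A) (hφ : Function.Injective φ) :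
    UDCode B where
  enc t u := U.enc t (φ ∘ u)
  ud t := by
    intro l₁ l₂ h
    have hinj : Function.Injective fun u : Fin t → B => φ ∘ u := hφ.comp_left
    refine hinj.list_map (U.ud t ?_)
    simpa [List.map_map, Function.comp_def] using h

theorem UDCode.ae_eventually_neg_log_prefixProb_le {A : Type} [Fintype A] [MeasurableSpace A]
    [MeasurableSingletonClass A] (U : UDCode A) (μ : Measure (ℕ → A)) [IsProbabilityMeasure μ] :
    ∀ᵐ x ∂μ, ∀ᶠ t : ℕ in atTop, (t : ℝ)⁻¹ * -Real.log (prefixProb μ t x) ≤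
      (U.enc t (prefixWord t x)).length / t * Real.log 2 + 2 * (Real.log t / t) := by
  have h := ae_eventually_le_sq_mul_prefixProb μ
    (q := fun t x => (2 : ℝ) ^ (-((U.enc t (prefixWord t x)).length : ℤ)))
    (fun t x => by positivity)
    (fun t => dependsOn_comp_prefixWord t fun u => (2 : ℝ) ^ (-((U.enc t u).length : ℤ)))
    (fun t x => by
      simp only [transferOp_iterate_apply, prefixWord_appendSeq]
      exact U.kraft_sum_le_one t)
  filter_upwards [h, ae_forall_prefixProb_pos μ] with x hx hpos
  filter_upwards [hx, eventually_gt_atTop 0] with t ht ht0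
  have ht' : (0 : ℝ) < t := by exact_mod_cast ht0
  have h1 := Real.log_le_log (by positivity) ht
  rw [Real.log_zpow, Real.log_mul (by positivity) (hpos t).ne', Real.log_pow] at h1
  rw [inv_mul_le_iff₀ ht']
  push_cast at h1
  field_simp
  linarith

theorem tendsto_log_natCast_div : Tendsto (fun t : ℕ => Real.log t / t) atTop (nhds 0) :=
  Real.isLittleO_log_id_atTop.tendsto_div_nhds_zero.comp tendsto_natCast_atTop_atTop

/-- The **Shannon–McMillan–Breiman theorem**, for an alphabet that has a universal code. -/
theorem ae_tendsto_neg_log_prefixProb {A : Type} [Fintype A] [MeasurableSpace A]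
    [MeasurableSingletonClass A] {U : UDCode A} (hU : IsUniversal U) (μ : Measure (ℕ → A))
    [IsProbabilityMeasure μ] (hμ : Ergodic (shiftMap A) μ) :
    ∀ᵐ x ∂μ, Tendsto (fun t : ℕ => (t : ℝ)⁻¹ * -Real.log (prefixProb μ t x)) atTop
      (nhds (entRate μ * Real.log 2)) := by
  have hlow : ∀ᵐ x ∂μ, ∀ c : ℚ, (c : ℝ) < entRate μ * Real.log 2 →
      ∀ᶠ n : ℕ in atTop, prefixProb μ n x < Real.exp (-(n * c)) :=
    ae_all_iff.2 fun c => by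
      by_cases hc : (c : ℝ) < entRate μ * Real.log 2
      · simpa [hc] using ae_eventually_prefixProb_lt μ hμ hc
      · simp [hc]
  filter_upwards [hlow, U.ae_eventually_neg_log_prefixProb_le μ, ae_forall_prefixProb_pos μ,
    (hU μ inferInstance hμ).1] with x hx1 hx2 hpos hx3
  have hup := (hx3.mul_const (Real.log 2)).add (tendsto_log_natCast_div.const_mul 2)
  rw [mul_zero, add_zero] at hup
  refine tendsto_order.2 ⟨fun c hc => ?_, fun c hc => ?_⟩
  · obtain ⟨c', hcc', hc'⟩ := exists_rat_btwn hc
    filter_upwards [hx1 c' hc', eventually_gt_atTop 0] with t ht ht0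
    have ht' : (0 : ℝ) < t := by exact_mod_cast ht0
    have h1 := Real.log_lt_log (hpos t) ht
    rw [Real.log_exp] at h1
    rw [lt_inv_mul_iff₀ ht']
    nlinarith
  · filter_upwards [hx2, hup.eventually_lt_const hc] with t h1 h2
    exact h1.trans_lt h2

theorem condEnt_dirac {A : Type} [Fintype A] [MeasurableSpace A] (y : ℕ → A) (m : ℕ) :
    condEnt (Measure.dirac y) m = 0 := by
  have h01 {t : ℕ} (u : Fin t → A) : wordProb (Measure.dirac y) u = 0 ∨
      wordProb (Measure.dirac y) u = 1 := by
    rcases Measure.dirac_apply_eq_zero_or_one (a := y)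
      (s := {x : ℕ → A | ∀ i : Fin t, x i.val = u i}) with h | h <;> simp [wordProb, h]
  rw [condEnt, neg_eq_zero]
  refine Finset.sum_eq_zero fun v _ => mul_eq_zero_of_right _ (Finset.sum_eq_zero fun a _ => ?_)
  rcases h01 (Fin.snoc v a : Fin (m + 1) → A) with h | h <;> rcases h01 v with h' | h' <;>
    simp [h, h']

theorem entRate_dirac {A : Type} [Fintype A] [MeasurableSpace A] (y : ℕ → A) :
    entRate (Measure.dirac y) = 0 := by
  simp only [entRate, condEnt_dirac]
  exact tendsto_const_nhds.limUnder_eq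

theorem ergodic_dirac_const {A : Type} [MeasurableSpace A] (a : A) :
    Ergodic (shiftMap A) (Measure.dirac fun _ : ℕ => a) where
  measurable := measurable_shiftMap A
  map_eq := Measure.map_dirac' (measurable_shiftMap A) _
  aeconst_set s hs _ := by
    rw [eventuallyConst_set']
    by_cases h : (fun _ : ℕ => a) ∈ s
    · right
      rw [eventuallyEq_univ, mem_ae_iff, Measure.dirac_apply' _ hs.compl]
      simp [h]
    · left
      rw [eventuallyEq_empty]
      refine measure_mono_null (t := s) (fun x hx => by simpa using hx) ?_
      rw [Measure.dirac_apply' _ hs]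
      simp [h]

theorem IsUniversal.ae_dirac_const {A : Type} [Fintype A] [MeasurableSpace A] {U : UDCode A}
    (hU : IsUniversal U) (a : A) :
    ∀ᵐ x ∂(Measure.dirac fun _ : ℕ => a),
      Tendsto (fun t : ℕ => ((U.enc t (prefixWord t x)).length : ℝ) / t) atTop (nhds 0) := by
  have := (hU (Measure.dirac fun _ => a) inferInstance (ergodic_dirac_const a)).1
  rwa [entRate_dirac] at this

theorem ae_dirac_self {α : Type*} [MeasurableSpace α] {a : α} {P : α → Prop}
    (h : ∀ᵐ x ∂(Measure.dirac a), P x) : P a := by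
  by_contra ha
  have h1 : Measure.dirac a {x | ¬P x} = 0 := h
  rw [Measure.dirac_apply_of_mem (show a ∈ {x | ¬P x} from ha)] at h1
  exact one_ne_zero h1

theorem exists_ne_forall_measurableSet_mem {A : Type*} [Countable A] [MeasurableSpace A]
    {a : A} (ha : ¬MeasurableSet {a}) :
    ∃ b, b ≠ a ∧ ∀ s, MeasurableSet s → (a ∈ s ↔ b ∈ s) := by
  by_contra! hcon
  refine ha ?_
  have : measurableAtom a = {a} := by
    refine Set.Subset.antisymm (fun b hb => ?_) (by simp)
    by_contra hba
    obtain ⟨s, hs, h⟩ := hcon b hba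
    rcases h with ⟨h1, h2⟩ | ⟨h1, h2⟩
    · exact h2 (mem_of_mem_measurableAtom hb hs h1)
    · exact (mem_of_mem_measurableAtom hb hs.compl h1) h2
  exact this ▸ MeasurableSet.measurableAtom_of_countable a

theorem UDCode.exists_not_tendsto_length_div (U : UDCode Bool) :
    ∃ z : ℕ → Bool,
      ¬Tendsto (fun t : ℕ => ((U.enc t (prefixWord t z)).length : ℝ) / t) atTop (nhds 0) := by
  let ν : Measure (ℕ → Bool) := Measure.infinitePi fun _ => (PMF.uniformOfFintype Bool).toMeasure
  have hp (t : ℕ) (z : ℕ → Bool) : prefixProb ν t z = (2⁻¹ : ℝ) ^ t := by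
    have hset : {x : ℕ → Bool | ∀ i : Fin t, x i.val = prefixWord t z i} =
        Set.pi (Finset.range t) fun i => {z i} := by
      ext x
      simp only [Set.mem_ofPred_eq, Set.mem_pi, Finset.coe_range, Set.mem_Iio,
        Set.mem_singleton_iff]
      exact ⟨fun h i hi => h ⟨i, hi⟩, fun h i => h i i.isLt⟩
    rw [prefixProb, wordProb, hset, Measure.infinitePi_pi _ fun i _ => measurableSet_singleton _]
    simp
  obtain ⟨z, hz⟩ := (U.ae_eventually_neg_log_prefixProb_le ν).exists
  refine ⟨z, fun hlim => ?_⟩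
  have hR := (hlim.mul_const (Real.log 2)).add (tendsto_log_natCast_div.const_mul 2)
  have hle := ge_of_tendsto hR (b := Real.log 2) (by
    filter_upwards [hz, eventually_gt_atTop 0] with t ht ht0
    have ht' : (0 : ℝ) < t := by exact_mod_cast ht0
    have h2 : (t : ℝ)⁻¹ * -(t * -Real.log 2) = Real.log 2 := by field_simp
    rw [hp, Real.log_pow, Real.log_inv, h2] at ht
    exact ht)
  have := Real.log_pos one_lt_two
  simp at hle
  linarith

theorem IsUniversal.measurableSingletonClass {A : Type} [Fintype A] [MeasurableSpace A]
    {U : UDCode A} (hU : IsUniversal U) : MeasurableSingletonClass A := by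
  refine ⟨fun a => ?_⟩
  by_contra ha
  obtain ⟨b, hba, hb⟩ := exists_ne_forall_measurableSet_mem ha
  let φ : Bool → A := fun c => if c then a else b
  have hφ : Function.Injective φ := by
    intro c d h
    cases c <;> cases d <;> simp [φ, hba, hba.symm] at h ⊢
  have hΦ : @Measurable _ _ ⊥ _ fun (z : ℕ → Bool) (n : ℕ) => φ (z n) := by
    refine @measurable_pi_lambda _ _ _ ⊥ _ _ fun n s hs => ?_
    rw [MeasurableSpace.measurableSet_bot_iff]
    by_cases has : a ∈ s
    · right
      ext z
      cases h : z n <;> simp [φ, h, has, (hb s hs).1 has]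
    · left
      ext z
      cases h : z n <;> simp [φ, h, has, mt (hb s hs).2 has]
  have hae := hU.ae_dirac_const a
  obtain ⟨T, hsub, hT, hT0⟩ := exists_measurable_superset_of_null hae
  obtain ⟨z, hz⟩ := (U.comap φ hφ).exists_not_tendsto_length_div
  have hzT : (fun n => φ (z n)) ∈ T := hsub hz
  rcases MeasurableSpace.measurableSet_bot_iff.1 (hΦ hT) with h | h
  · exact Set.eq_empty_iff_forall_notMem.1 h z hzT
  · have hconst : (fun _ : ℕ => a) ∈ T := by
      have := Set.eq_univ_iff_forall.1 h fun _ => true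
      simpa [φ] using this
    rw [Measure.dirac_apply_of_mem hconst] at hT0
    exact one_ne_zero hT0

theorem IsUniversal.tendsto_logb_kraft_sum {A : Type} [Fintype A] [Nonempty A]
    [MeasurableSpace A] {U : UDCode A} (hU : IsUniversal U) :
    Tendsto (fun t : ℕ => (t : ℝ)⁻¹ *
      Real.logb 2 (∑ v : Fin t → A, (2 : ℝ) ^ (-((U.enc t v).length : ℤ)))) atTop (nhds 0) := by
  obtain ⟨a⟩ := ‹Nonempty A›
  have h := (ae_dirac_self (hU.ae_dirac_const a)).neg
  rw [neg_zero] at h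
  refine tendsto_of_tendsto_of_tendsto_of_le_of_le h tendsto_const_nhds (fun t => ?_) fun t => ?_
  · simp only
    rw [neg_div', div_eq_inv_mul]
    refine mul_le_mul_of_nonneg_left ?_ (by positivity)
    have := Finset.single_le_sum (f := fun v : Fin t → A =>
      (2 : ℝ) ^ (-((U.enc t v).length : ℤ))) (fun _ _ => by positivity)
      (Finset.mem_univ (prefixWord t fun _ => a))
    rw [Real.le_logb_iff_rpow_le one_lt_two (lt_of_lt_of_le (by positivity) this)]
    exact_mod_cast this
  · refine mul_nonpos_of_nonneg_of_nonpos (by positivity) ?_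
    exact Real.logb_nonpos one_lt_two (Finset.sum_nonneg fun _ _ => by positivity)
      (U.kraft_sum_le_one t)

theorem logb_muU {A : Type} [Fintype A] (U : UDCode A) {t : ℕ} (u : Fin t → A) :
    Real.logb 2 (muU U u) = -((U.enc t u).length : ℝ) -
      Real.logb 2 (∑ v : Fin t → A, (2 : ℝ) ^ (-((U.enc t v).length : ℤ))) := by
  have hK : 0 < ∑ v : Fin t → A, (2 : ℝ) ^ (-((U.enc t v).length : ℤ)) :=
    Finset.sum_pos (fun _ _ => by positivity) ⟨u, Finset.mem_univ u⟩
  rw [muU, Real.logb_div (by positivity) hK.ne', ← Real.rpow_intCast,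
    Real.logb_rpow (by norm_num) (by norm_num)]
  push_cast
  rfl

theorem muU_pos {A : Type} [Fintype A] (U : UDCode A) {t : ℕ} (u : Fin t → A) : 0 < muU U u :=
  div_pos (by positivity) (Finset.sum_pos (fun _ _ => by positivity) ⟨u, Finset.mem_univ u⟩)

/-- Theorem 2 of the paper: `μ_U` is a consistent estimator.
For a universal code `U` and any stationary ergodic source `P`,
`(1/t)(−log P(x_1…x_t) + log μ_U(x_1…x_t)) → 0` a.s., and
`(1/t) Σ_u P(u) log(P(u)/μ_U(u)) → 0`. -/
theorem universal_code_estimation (A : Type) [Fintype A] [MeasurableSpace A]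
    (U : UDCode A) (hU : IsUniversal U)
    (μ : Measure (ℕ → A)) (hprob : IsProbabilityMeasure μ)
    (herg : Ergodic (shiftMap A) μ) :
    (∀ᵐ x ∂μ, Tendsto (fun t : ℕ => (t : ℝ)⁻¹ *
        (-Real.logb 2 (wordProb μ (prefixWord t x))
          - -Real.logb 2 (muU U (prefixWord t x))))
      atTop (nhds 0)) ∧
    Tendsto (fun t : ℕ =>
        (t : ℝ)⁻¹ * ∑ u : Fin t → A, wordProb μ u * Real.logb 2 (wordProb μ u / muU U u))
      atTop (nhds 0) := by
  have hA : Nonempty A := ⟨(nonempty_of_isProbabilityMeasure μ).some 0⟩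
  have hmeas := hU.measurableSingletonClass
  have hlog := (Real.log_pos one_lt_two).ne'
  have hkraft := hU.tendsto_logb_kraft_sum
  obtain ⟨hU1, hU2⟩ := hU μ hprob herg
  constructor
  · filter_upwards [hU1, ae_tendsto_neg_log_prefixProb hU μ herg] with x h1 h2
    have h := ((h2.div_const (Real.log 2)).sub h1).sub hkraft
    rw [mul_div_cancel_right₀ _ hlog, sub_self, sub_zero] at h
    refine h.congr fun t => ?_
    rw [logb_muU, prefixProb, ← Real.log_div_log (x := wordProb μ (prefixWord t x))]
    ring
  · have h := (hU2.sub ((tendsto_blockEnt_div μ herg.toMeasurePreserving).div_const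
      (Real.log 2))).add hkraft
    rw [mul_div_cancel_right₀ _ hlog, sub_self, zero_add] at h
    refine h.congr fun t => ?_
    set L := Real.logb 2 (∑ v : Fin t → A, (2 : ℝ) ^ (-((U.enc t v).length : ℤ))) with hL
    have hterm (u : Fin t → A) : wordProb μ u * Real.logb 2 (wordProb μ u / muU U u) =
        wordProb μ u * Real.log (wordProb μ u) / Real.log 2 +
          wordProb μ u * ((U.enc t u).length : ℝ) + wordProb μ u * L := by
      by_cases h0 : wordProb μ u = 0
      · simp [h0]
      · rw [Real.logb_div h0 (muU_pos U u).ne', logb_muU, ← hL, Real.logb]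
        ring
    have hone : ∑ u : Fin t → A, wordProb μ u = 1 := by
      simpa using (integral_comp_prefixWord μ t fun _ => 1).2.symm
    rw [(integral_comp_prefixWord μ t fun u => ((U.enc t u).length : ℝ)).2, blockEnt_eq_sum]
    simp only [hterm, Finset.sum_add_distrib]
    rw [← Finset.sum_mul, ← Finset.sum_div, hone]
    ring
end
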